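/- arXiv:2004.08199 — 3 statements merged into one kernel-verified Lean document; each statement's English description precedes it below -/
import Mathlib

section
/- The number of conjugacy classes of elements of finite order in PSL_2(Z[1/2]) is 6: the identity, one class of elements of order 2, and four classes of elements of order 3. -/
/-- `PSL₂(ℤ[1/2])`: the quotient of `SL₂` over the localization `ℤ[1/2]` by its center. -/
abbrev PSL2ZHalf : Type _ :=
  Matrix.SpecialLinearGroup (Fin 2) (Localization.Away (2 : ℤ)) ⧸
    Subgroup.center (Matrix.SpecialLinearGroup (Fin 2) (Localization.Away (2 : ℤ)))


namespace PslHalf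

abbrev R : Type := Localization.Away (2 : ℤ)
abbrev SL : Type := Matrix.SpecialLinearGroup (Fin 2) R

instance instDom : IsDomain R :=
  IsLocalization.isDomain_localization (M := Submonoid.powers (2 : ℤ))
    (powers_le_nonZeroDivisors_of_noZeroDivisors (by norm_num))

lemma cast_inj : Function.Injective (Int.cast : ℤ → R) := by
  have h := IsLocalization.injective (M := Submonoid.powers (2 : ℤ)) R
    (powers_le_nonZeroDivisors_of_noZeroDivisors (by norm_num))
  intro a b hab
  apply h
  simpa using hab

instance instChar : CharZero R := ⟨fun a b h => by
  have : ((a : ℤ) : R) = ((b : ℤ) : R) := by simpa using h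
  exact_mod_cast cast_inj this⟩

lemma isUnit_two : IsUnit (2 : R) := by
  have := IsLocalization.Away.algebraMap_isUnit (S := R) (2 : ℤ)
  simpa using this

noncomputable def two : Rˣ := isUnit_two.unit

@[simp] lemma two_val : (two : R) = 2 := rfl

lemma two_mul_inv : (2 : R) * ((two⁻¹ : Rˣ) : R) = 1 := by
  have := two.mul_inv
  simpa using this

lemma exists_num (x : R) : ∃ (k : ℕ) (m : ℤ), (2 : R) ^ k * x = m := by
  obtain ⟨n, a, h⟩ := IsLocalization.Away.surj (2 : ℤ) x
  refine ⟨n, a, ?_⟩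
  rw [mul_comm]
  simpa using h

lemma exists_odd (x : R) (hx : x ≠ 0) : ∃ (u : Rˣ) (n : ℕ), Odd n ∧ x = u * n := by
  obtain ⟨k, m, h⟩ := exists_num x
  have hm : m ≠ 0 := by
    rintro rfl
    simp at h
    exact hx h
  obtain ⟨l, n, hn, hl⟩ := Nat.exists_eq_two_pow_mul_odd (n := m.natAbs) (by simpa using hm)
  have hx' : x = ((two ^ k)⁻¹ : Rˣ) * (m : R) := by
    rw [Units.eq_inv_mul_iff_mul_eq]; simpa using h
  rcases Int.natAbs_eq m with h1 | h1
  · refine ⟨(two ^ k)⁻¹ * two ^ l, n, hn, ?_⟩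
    rw [hx', h1, hl]; push_cast; simp [mul_assoc]
  · refine ⟨-((two ^ k)⁻¹ * two ^ l), n, hn, ?_⟩
    rw [hx', h1, hl]; push_cast; simp [mul_assoc]; ring

/-- an odd integer dividing an integer in `R` divides it in `ℤ`. -/
lemma odd_dvd (n z : ℤ) (hn : Odd n) (y : R) (h : (z : R) = n * y) : n ∣ z := by
  obtain ⟨k, m, hk⟩ := exists_num y
  have h1 : ((2 ^ k * z : ℤ) : R) = ((n * m : ℤ) : R) := by
    push_cast
    rw [h, ← hk]; ring
  have h2 := cast_inj h1
  have h3 : IsCoprime n (2 ^ k) := by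
    apply IsCoprime.pow_right
    rw [Int.isCoprime_iff_gcd_eq_one]
    exact Int.isCoprime_iff_gcd_eq_one.1 (by obtain ⟨r, rfl⟩ := hn; exact ⟨1, -r, by ring⟩)
  exact h3.dvd_of_dvd_mul_left ⟨m, h2⟩

lemma unit_form (u : Rˣ) : ∃ (j : ℕ) (e : ℤˣ), (2 : R) ^ j * u = (e : ℤ) ∨
    (u : R) = (2 : R) ^ j * (e : ℤ) := by
  obtain ⟨k, m, h⟩ := exists_num u
  obtain ⟨k', m', h'⟩ := exists_num ((u⁻¹ : Rˣ) : R)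
  have h1 : ((m * m' : ℤ) : R) = ((2 ^ (k + k') : ℤ) : R) := by
    push_cast
    rw [← h, ← h', pow_add]
    linear_combination 2 ^ k * 2 ^ k' * u.mul_inv
  have h2 := cast_inj h1
  have h3 : m ∣ 2 ^ (k + k') := ⟨m', h2.symm⟩
  obtain ⟨i, hi, h4⟩ := (dvd_prime_pow Int.prime_two _).1 h3
  obtain ⟨e, he⟩ := h4.symm
  have he' : m = 2 ^ i * e := he.symm
  rcases le_total i k with hik | hik
  · obtain ⟨j, rfl⟩ := Nat.exists_eq_add_of_le hik
    refine ⟨j, e, Or.inl ?_⟩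
    rw [he'] at h
    push_cast at h
    have h2 : (2 : R) ^ i ≠ 0 := pow_ne_zero _ two_ne_zero
    apply mul_left_cancel₀ h2
    rw [← h]; ring
  · obtain ⟨j, rfl⟩ := Nat.exists_eq_add_of_le hik
    refine ⟨j, e, Or.inr ?_⟩
    rw [he'] at h
    push_cast at h
    have h2 : (2 : R) ^ k ≠ 0 := pow_ne_zero _ two_ne_zero
    apply mul_left_cancel₀ h2
    rw [h]; ring

def mk (a b c d : R) (h : a * d - b * c = 1) : SL :=
  ⟨!![a, b; c, d], by rw [Matrix.det_fin_two_of]; exact h⟩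

lemma exists_mk (g : SL) : ∃ a b c d h, g = mk a b c d h := by
  refine ⟨g.1 0 0, g.1 0 1, g.1 1 0, g.1 1 1, ?_, ?_⟩
  · rw [← Matrix.det_fin_two]; exact g.2
  · apply Subtype.ext
    exact Matrix.eta_fin_two _

lemma mk_mul (a b c d h a' b' c' d' h') :
    mk a b c d h * mk a' b' c' d' h' =
      mk (a * a' + b * c') (a * b' + b * d') (c * a' + d * c') (c * b' + d * d')
        (by linear_combination (a' * d' - b' * c') * h + h') := by
  apply Subtype.ext
  rw [Matrix.SpecialLinearGroup.coe_mul]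
  exact Matrix.mul_fin_two _ _ _ _ _ _ _ _

lemma mk_inj {a b c d h a' b' c' d' h'} (e : mk a b c d h = mk a' b' c' d' h') :
    a = a' ∧ b = b' ∧ c = c' ∧ d = d' := by
  have e1 := congrArg (fun g : SL => g.1 0 0) e
  have e2 := congrArg (fun g : SL => g.1 0 1) e
  have e3 := congrArg (fun g : SL => g.1 1 0) e
  have e4 := congrArg (fun g : SL => g.1 1 1) e
  simp [mk] at e1 e2 e3 e4
  exact ⟨e1, e2, e3, e4⟩

lemma mk_congr {a b c d h a' b' c' d' h'} (e1 : a = a') (e2 : b = b') (e3 : c = c')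
    (e4 : d = d') : mk a b c d h = mk a' b' c' d' h' := by
  subst e1 e2 e3 e4; rfl

lemma one_eq : (1 : SL) = mk 1 0 0 1 (by ring) := by
  apply Subtype.ext
  simp [mk, Matrix.one_fin_two]

lemma conj_mk (p q r s : R) (hp : p * s - q * r = 1) {a b c d h a' b' c' d' h'}
    (e1 : p * a + q * c = a' * p + b' * r) (e2 : p * b + q * d = a' * q + b' * s)
    (e3 : r * a + s * c = c' * p + d' * r) (e4 : r * b + s * d = c' * q + d' * s) :
    IsConj (mk a b c d h) (mk a' b' c' d' h') := by
  rw [isConj_iff]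
  refine ⟨mk p q r s hp, ?_⟩
  rw [mul_inv_eq_iff_eq_mul, mk_mul, mk_mul]
  exact mk_congr e1 e2 e3 e4

/-- The normal form. -/
noncomputable def nf (t : R) (w : Rˣ) : SL := mk 0 (-w) (w⁻¹ : Rˣ) t
  (by linear_combination w.mul_inv)

lemma definite (t : ℤ) (ht : t = 0 ∨ t = -1) (a : R) : a ^ 2 - t * a + 1 ≠ 0 := by
  intro h
  obtain ⟨k, m, hk⟩ := exists_num a
  have h1 : ((m ^ 2 - t * m * 2 ^ k + (2 ^ k) ^ 2 : ℤ) : R) = ((0 : ℤ) : R) := by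
    push_cast
    rw [← hk]
    linear_combination (2 ^ k) ^ 2 * h
  have h2 := cast_inj h1
  have h3 : (0 : ℤ) < 2 ^ k := by positivity
  rcases ht with rfl | rfl
  · nlinarith [sq_nonneg m]
  · nlinarith [sq_nonneg (2 * m + 2 ^ k)]

lemma exists_residue (n : ℕ) (hn : Odd n) (a : R) :
    ∃ (s : R) (j : ℤ), a + s * n = j ∧ 2 * |j| < n := by
  obtain ⟨k, m, hk⟩ := exists_num a
  have h3 : IsCoprime (n : ℤ) (2 ^ k) := by
    apply IsCoprime.pow_right
    obtain ⟨r, rfl⟩ := hn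
    exact ⟨1, -r, by push_cast; ring⟩
  obtain ⟨x, y, hxy⟩ := h3
  have hn0 : (0 : ℤ) < n := by have := hn.pos; exact_mod_cast this
  -- a ≡ y m, as 2^k (a - y m) = m - 2^k y m = m x n
  obtain ⟨r, hr⟩ := hn
  obtain ⟨j, z, hj, hj2⟩ : ∃ j z : ℤ, j = y * m + z * n ∧ 2 * |j| < n := by
    refine ⟨(y * m + r) % n - r, -((y * m + r) / n), ?_, ?_⟩
    · have := Int.emod_add_mul_ediv (y * m + r) n
      linarith
    · have h1 := Int.emod_nonneg (y * m + r) hn0.ne'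
      have h2 := Int.emod_lt_of_pos (y * m + r) hn0
      have : 2 * |(y * m + r) % n - (r : ℤ)| ≤ 2 * r := by
        have : |(y * m + r) % n - (r : ℤ)| ≤ r := by
          rw [abs_le]; constructor
          · linarith
          · have : (n : ℤ) = 2 * r + 1 := by exact_mod_cast hr
            linarith
        linarith
      have : (n : ℤ) = 2 * r + 1 := by exact_mod_cast hr
      linarith
  refine ⟨z - x * m * ((two ^ k)⁻¹ : Rˣ), j, ?_, hj2⟩
  have hu : (2 : R) ^ k * ((two ^ k)⁻¹ : Rˣ) = 1 := by
    have := (two ^ k).mul_inv; simpa using this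
  have hxy' : (x : R) * n + y * 2 ^ k = 1 := by exact_mod_cast congrArg (Int.cast : ℤ → R) hxy
  rw [hj, Int.cast_add, Int.cast_mul, Int.cast_mul, Int.cast_natCast]
  have h2 : (2 : R) ^ k ≠ 0 := pow_ne_zero _ two_ne_zero
  apply mul_left_cancel₀ h2
  linear_combination hk - (x * m * n) * hu - m * hxy'

lemma descent (t : ℤ) (ht : t = 0 ∨ t = -1) : ∀ (n : ℕ) (a b c d : R) (h : a * d - b * c = 1)
    (u : Rˣ), Odd n → c = u * n → a + d = t → ∃ w : Rˣ, IsConj (mk a b c d h) (nf t w) := by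
  intro n
  induction n using Nat.strong_induction_on with
  | _ n ih =>
  intro a b c d h u hn hc had
  by_cases hn1 : n = 1
  · subst hn1
    refine ⟨u⁻¹, ?_⟩
    have hu : (u : R) * ((u⁻¹ : Rˣ) : R) = 1 := u.mul_inv
    have hc' : c = u := by simpa using hc
    subst hc'
    have hd : d = t - a := by linear_combination had
    subst hd
    refine conj_mk 1 (-a * (u⁻¹ : Rˣ)) 0 1 (by ring) ?_ ?_ ?_ ?_
    · linear_combination (-a) * hu
    · linear_combination (-b) * hu - (u⁻¹ : Rˣ) * h
    · simp
    · simp; linear_combination a * hu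
  · obtain ⟨s, j, hs, hj⟩ := exists_residue n hn a
    have hu : (u : R) * ((u⁻¹ : Rˣ) : R) = 1 := u.mul_inv
    -- conjugate by the translation
    set s' : R := s * (u⁻¹ : Rˣ) with hs'
    have hj' : a + s' * c = j := by rw [hs', hc]; linear_combination hs + s * n * hu
    set b' : R := b + s' * d - s' * j with hb'
    have hdet : (j : R) * (t - j) - b' * c = 1 := by
      rw [hb', ← hj']; linear_combination h - (a + s' * c) * had
    have hb0 : b' ≠ 0 := by
      intro h0
      apply definite t ht j
      rw [h0] at hdet
      linear_combination -hdet
    obtain ⟨v, n', hn', hv⟩ := exists_odd b' hb0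
    have hlt : n' < n := by
      have e1 : ((j ^ 2 - t * j + 1 : ℤ) : R) = ((n * n' : ℕ) : ℤ) * (-(u * v : R)) := by
        push_cast
        rw [hv, hc] at hdet
        linear_combination -hdet
      have e2 := odd_dvd _ _ (by exact_mod_cast hn.mul hn') _ e1
      have hjs : |j| ^ 2 = j ^ 2 := sq_abs j
      have hn3 : (3 : ℤ) ≤ n := by
        obtain ⟨r, hr⟩ := hn; omega
      have h5 : j ^ 2 - t * j + 1 ≤ |j| ^ 2 + |j| + 1 := by
        rcases ht with rfl | rfl
        · have := abs_nonneg j; linarith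
        · have := le_abs_self j; linarith
      have h6 : 0 < j ^ 2 - t * j + 1 := by
        rcases ht with rfl | rfl
        · nlinarith
        · nlinarith [sq_nonneg (2 * j + 1)]
      have h7 := Int.le_of_dvd h6 e2
      push_cast at h7
      by_contra hcon
      have h8 : (n : ℤ) ≤ n' := by exact_mod_cast not_lt.1 hcon
      have := abs_nonneg j
      nlinarith
    obtain ⟨w, hw⟩ := ih n' hlt (t - j) (-c) (-b') j (by linear_combination hdet) (-v) hn'
      (by rw [hv]; simp) (by ring)
    refine ⟨w, IsConj.trans ?_ hw⟩
    refine IsConj.trans (b := mk j b' c (t - j) hdet) ?_ ?_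
    · refine conj_mk 1 s' 0 1 (by ring) ?_ ?_ ?_ ?_
      · linear_combination hj'
      · rw [hb']; ring
      · ring
      · linear_combination had - hj'
    · refine conj_mk 0 1 (-1) 0 (by ring) ?_ ?_ ?_ ?_ <;> ring

lemma exists_nf (t : ℤ) (ht : t = 0 ∨ t = -1) (a b c d : R) (h : a * d - b * c = 1)
    (had : a + d = t) : ∃ w : Rˣ, IsConj (mk a b c d h) (nf t w) := by
  have hc : c ≠ 0 := by
    rintro rfl
    apply definite t ht a
    have hd : d = t - a := by linear_combination had
    subst hd
    linear_combination -h
  obtain ⟨u, n, hn, hc⟩ := exists_odd c hc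
  exact descent t ht n a b c d h u hn hc had

lemma nf_sq (t : R) (w z : Rˣ) : IsConj (nf t w) (nf t (w * z ^ 2)) := by
  have hz : (z : R) * ((z⁻¹ : Rˣ) : R) = 1 := z.mul_inv
  refine conj_mk z 0 0 (z⁻¹ : Rˣ) (by simp) ?_ ?_ ?_ ?_
  · simp
  · simp; linear_combination ((z : R) * w) * hz
  · have h1 : z⁻¹ * w⁻¹ = (w * z ^ 2)⁻¹ * z := by
      rw [eq_inv_mul_iff_mul_eq, pow_two]
      calc w * (z * z) * (z⁻¹ * w⁻¹) = w * w⁻¹ * (z * z⁻¹) * z := by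
            simp only [mul_assoc, mul_comm, mul_left_comm]
        _ = z := by simp
    have h2 := congrArg (Units.val) h1
    rw [Units.val_mul, Units.val_mul] at h2
    linear_combination h2
  · simp; ring

lemma unit_form' (u : Rˣ) : ∃ (n : ℤ) (e : Rˣ), (e = 1 ∨ e = -1) ∧ u = e * two ^ n := by
  obtain ⟨j, e, h⟩ := unit_form u
  have he : ∃ e' : Rˣ, (e' = 1 ∨ e' = -1) ∧ (e' : R) = ((e : ℤ) : R) := by
    rcases Int.units_eq_one_or e with rfl | rfl
    · exact ⟨1, Or.inl rfl, by simp⟩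
    · exact ⟨-1, Or.inr rfl, by simp⟩
  obtain ⟨e', h1, h2⟩ := he
  rcases h with h | h
  · refine ⟨-j, e', h1, ?_⟩
    rw [zpow_neg, eq_mul_inv_iff_mul_eq]
    apply Units.ext
    rw [h2, ← h]
    simp [mul_comm]
  · refine ⟨j, e', h1, ?_⟩
    apply Units.ext
    rw [h, ← h2]
    simp [mul_comm]

noncomputable def rep : Fin 4 → Rˣ := ![1, -1, two, -two]
def repZ : Fin 4 → ℤ := ![1, -1, 2, -2]

lemma rep_val (i : Fin 4) : (rep i : R) = (repZ i : ℤ) := by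
  fin_cases i <;> simp [rep, repZ]

lemma nf_rep (t : R) (w : Rˣ) : ∃ i, IsConj (nf t w) (nf t (rep i)) := by
  obtain ⟨n, e, he, rfl⟩ := unit_form' w
  obtain ⟨k, hk | hk⟩ := Int.even_or_odd' n
  · have h := nf_sq t (e * two ^ n) (two ^ (-k))
    have h2 : e * two ^ n * (two ^ (-k)) ^ 2 = e := by
      rw [mul_assoc, ← zpow_natCast, ← zpow_mul, ← zpow_add, hk]
      simp [mul_comm]
    rw [h2] at h
    rcases he with rfl | rfl
    · exact ⟨0, h⟩
    · exact ⟨1, h⟩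
  · have h := nf_sq t (e * two ^ n) (two ^ (-k))
    have h2 : e * two ^ n * (two ^ (-k)) ^ 2 = e * two := by
      rw [mul_assoc, ← zpow_natCast, ← zpow_mul, ← zpow_add, hk]
      have : 2 * k + 1 + -k * ((2 : ℕ) : ℤ) = 1 := by push_cast; ring
      rw [this, zpow_one]
    rw [h2] at h
    rcases he with rfl | rfl
    · exact ⟨2, by simpa [rep] using h⟩
    · exact ⟨3, by rw [neg_one_mul two] at h; exact h⟩

lemma units_neg_inv (u : Rˣ) : (-u)⁻¹ = -u⁻¹ :=
  inv_eq_of_mul_eq_one_right (by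
    apply Units.ext
    rw [Units.val_mul, Units.val_neg, Units.val_neg, Units.val_one]
    linear_combination u.mul_inv)

lemma nf_zero (w : Rˣ) : IsConj (nf 0 w) (nf 0 1) ∨ IsConj (nf 0 w) (nf 0 (-1)) := by
  obtain ⟨i, hi⟩ := nf_rep 0 w
  have ht := two_mul_inv
  fin_cases i
  · exact Or.inl hi
  · exact Or.inr hi
  · refine Or.inl (hi.trans (IsConj.symm ?_))
    refine conj_mk 1 (-1) (two⁻¹ : Rˣ) (two⁻¹ : Rˣ) (by linear_combination ht) ?_ ?_ ?_ ?_ <;>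
      simp [rep]
    all_goals first | ring1 | linear_combination ht | linear_combination -ht
  · refine Or.inr (hi.trans (IsConj.symm ?_))
    refine conj_mk 1 (-1) (two⁻¹ : Rˣ) (two⁻¹ : Rˣ) (by linear_combination ht) ?_ ?_ ?_ ?_ <;>
      simp [rep, units_neg_inv]
    all_goals first | ring1 | linear_combination ht | linear_combination -ht

lemma norm_of_conj (u w : Rˣ) (h : IsConj (nf (-1) u) (nf (-1) w)) :
    ∃ X Y : R, (u : R) = w * (X ^ 2 + X * Y + Y ^ 2) := by
  rw [isConj_iff] at h
  obtain ⟨g, hg⟩ := h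
  obtain ⟨p, q, r, s, hd, rfl⟩ := exists_mk g
  rw [mul_inv_eq_iff_eq_mul, nf, nf, mk_mul, mk_mul] at hg
  obtain ⟨e1, e2, e3, e4⟩ := mk_inj hg
  have hu : (u : R) * ((u⁻¹ : Rˣ) : R) = 1 := u.mul_inv
  have hw : (w : R) * ((w⁻¹ : Rˣ) : R) = 1 := w.mul_inv
  refine ⟨s, u * r, ?_⟩
  have hq : q = -u * w * r := by linear_combination u * e1 - q * hu
  have hp : u * p = w * s + u * w * r := by linear_combination -e2 - hq
  linear_combination -u * hd + s * hp - u * r * hq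

lemma no_two (k : ℕ) : ∀ m l : ℤ, m ^ 2 + m * l + l ^ 2 ≠ 2 * 4 ^ k := by
  have key : ∀ m l : ℤ, Even (m ^ 2 + m * l + l ^ 2) → Even m ∧ Even l := by
    intro m l h
    simp only [Int.even_add, Int.even_mul, Int.even_pow] at h
    tauto
  induction k with
  | zero =>
    intro m l h
    obtain ⟨⟨a, rfl⟩, ⟨b, rfl⟩⟩ := key m l (by rw [h]; simp)
    have : 4 * (a ^ 2 + a * b + b ^ 2) = 2 := by linear_combination h
    omega
  | succ k ih =>
    intro m l h
    obtain ⟨⟨a, rfl⟩, ⟨b, rfl⟩⟩ := key m l (by rw [h]; simp)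
    apply ih a b
    have : 4 * (a ^ 2 + a * b + b ^ 2) = 4 * (2 * 4 ^ k) := by linear_combination h
    linarith

lemma repZ_inj (i j : Fin 4) (k : ℕ) (m l : ℤ)
    (h : repZ i * 4 ^ k = repZ j * (m ^ 2 + m * l + l ^ 2)) : i = j := by
  have h1 := no_two k m l
  have h2 := no_two k (2 * m) (2 * l)
  have h3 : (2 * m) ^ 2 + (2 * m) * (2 * l) + (2 * l) ^ 2 = 4 * (m ^ 2 + m * l + l ^ 2) := by ring
  rw [h3] at h2
  have h4 : 0 ≤ m ^ 2 + m * l + l ^ 2 := by nlinarith [sq_nonneg (m + l), sq_nonneg m, sq_nonneg l]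
  have h5 : (0 : ℤ) < 4 ^ k := by positivity
  generalize m ^ 2 + m * l + l ^ 2 = N at *
  generalize (4 : ℤ) ^ k = q at *
  fin_cases i <;> fin_cases j <;> simp [repZ] at h ⊢ <;> omega

lemma nf_inj (i j : Fin 4) (h : IsConj (nf (-1) (rep i)) (nf (-1) (rep j))) : i = j := by
  obtain ⟨X, Y, hXY⟩ := norm_of_conj _ _ h
  rw [rep_val, rep_val] at hXY
  obtain ⟨k, m, hm⟩ := exists_num X
  obtain ⟨k', l, hl⟩ := exists_num Y
  apply repZ_inj i j (k + k') (2 ^ k' * m) (2 ^ k * l)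
  apply cast_inj
  push_cast
  rw [← hm, ← hl, hXY, pow_add]
  have h4 : ∀ k : ℕ, (4 : R) ^ k = (2 ^ k) ^ 2 := fun k => by
    rw [← pow_mul, mul_comm, pow_mul]; norm_num
  rw [h4, h4]
  ring

/-! The projective group. -/

abbrev pr : SL →* PSL2ZHalf := QuotientGroup.mk' _

lemma mem_center (z : SL) : z ∈ Subgroup.center SL ↔
    z = 1 ∨ z = mk (-1) 0 0 (-1) (by ring) := by
  rw [Matrix.SpecialLinearGroup.mem_center_iff]
  constructor
  · rintro ⟨r, hr, h⟩
    have hr' : r = 1 ∨ r = -1 := by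
      rw [Fintype.card_fin] at hr
      have h0 : (r - 1) * (r + 1) = 0 := by linear_combination hr
      rcases mul_eq_zero.1 h0 with h1 | h1
      · left; linear_combination h1
      · right; linear_combination h1
    rcases hr' with rfl | rfl
    · left; apply Subtype.ext; rw [← h]; simp
    · right; apply Subtype.ext; rw [← h]; ext i j; fin_cases i <;> fin_cases j <;> simp [mk]
  · rintro (rfl | rfl)
    · exact ⟨1, by simp, by simp⟩
    · refine ⟨-1, by simp, ?_⟩
      ext i j; fin_cases i <;> fin_cases j <;> simp [mk]

lemma pr_eq (a b c d : R) (h) (a' b' c' d' : R) (h') : pr (mk a b c d h) = pr (mk a' b' c' d' h') ↔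
    (a' = a ∧ b' = b ∧ c' = c ∧ d' = d) ∨ (a' = -a ∧ b' = -b ∧ c' = -c ∧ d' = -d) := by
  have : pr (mk a b c d h) = pr (mk a' b' c' d' h') ↔
      (mk a b c d h)⁻¹ * (mk a' b' c' d' h') ∈ Subgroup.center SL := QuotientGroup.eq
  rw [this, mem_center, inv_mul_eq_iff_eq_mul, inv_mul_eq_iff_eq_mul, mul_one, mk_mul]
  constructor
  · rintro (e | e)
    · exact Or.inl (mk_inj e)
    · right
      obtain ⟨e1, e2, e3, e4⟩ := mk_inj e
      refine ⟨?_, ?_, ?_, ?_⟩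
      · rw [e1]; ring
      · rw [e2]; ring
      · rw [e3]; ring
      · rw [e4]; ring
  · rintro (⟨rfl, rfl, rfl, rfl⟩ | ⟨rfl, rfl, rfl, rfl⟩)
    · exact Or.inl rfl
    · exact Or.inr (mk_congr (by ring) (by ring) (by ring) (by ring))

lemma order_two (a b c d h) (had : a + d = 0) : orderOf (pr (mk a b c d h)) = 2 := by
  have hd : d = -a := by linear_combination had
  subst hd
  apply orderOf_eq_prime
  · rw [pow_two, ← map_mul, ← map_one pr, mk_mul, one_eq, pr_eq]
    right
    refine ⟨?_, ?_, ?_, ?_⟩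
    · linear_combination -h
    · ring
    · ring
    · linear_combination -h
  · rw [← map_one pr, one_eq]
    intro hh
    rw [pr_eq] at hh
    have h2 : (2 : R) ≠ 0 := two_ne_zero
    rcases hh with ⟨e1, e2, e3, e4⟩ | ⟨e1, e2, e3, e4⟩
    · exact h2 (by linear_combination e1 + e4)
    · exact h2 (by linear_combination e1 + e4)

lemma order_three (a b c d h) (had : a + d = -1) : orderOf (pr (mk a b c d h)) = 3 := by
  have hd : d = -1 - a := by linear_combination had
  subst hd
  apply orderOf_eq_prime
  · rw [pow_succ, pow_two, ← map_mul, ← map_mul, ← map_one pr, mk_mul, mk_mul, one_eq, pr_eq]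
    left
    refine ⟨?_, ?_, ?_, ?_⟩
    · linear_combination (a - 1) * h
    · linear_combination b * h
    · linear_combination c * h
    · linear_combination (-2 - a) * h
  · rw [← map_one pr, one_eq]
    intro hh
    rw [pr_eq] at hh
    rcases hh with ⟨e1, e2, e3, e4⟩ | ⟨e1, e2, e3, e4⟩
    · exact (show (3 : R) ≠ 0 by norm_num) (by linear_combination e1 + e4)
    · exact one_ne_zero (α := R) (by linear_combination e1 + e4)

def vseq (t : R) : ℕ → R
  | 0 => 0
  | 1 => 1
  | n + 2 => t * vseq t (n + 1) - vseq t n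

def wseq (m q : ℤ) : ℕ → ℤ
  | 0 => 0
  | 1 => 1
  | n + 2 => m * wseq m q (n + 1) - q ^ 2 * wseq m q n

lemma pow_mk (a b c d h) (n : ℕ) : ∃ hh, mk a b c d h ^ (n + 1) =
    mk (vseq (a + d) (n + 1) * a - vseq (a + d) n) (vseq (a + d) (n + 1) * b)
      (vseq (a + d) (n + 1) * c) (vseq (a + d) (n + 1) * d - vseq (a + d) n) hh := by
  induction n with
  | zero => exact ⟨by simpa [vseq] using h, by
    refine (pow_one _).trans ?_; apply mk_congr <;> simp [vseq]⟩
  | succ n ih =>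
    obtain ⟨hh, e⟩ := ih
    have e2 := pow_succ (mk a b c d h) (n + 1)
    rw [e, mk_mul] at e2
    have key : ∀ {x y z w hx x' y' z' w'}, mk a b c d h ^ (n + 1 + 1) = mk x y z w hx → x = x' →
        y = y' → z = z' → w = w' → ∃ hh, mk a b c d h ^ (n + 1 + 1) = mk x' y' z' w' hh := by
      rintro x y z w hx x' y' z' w' h1 rfl rfl rfl rfl
      exact ⟨hx, h1⟩
    refine key e2 ?_ ?_ ?_ ?_ <;> simp only [vseq]
    · linear_combination (-vseq (a + d) (n + 1)) * h
    · ring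
    · ring
    · linear_combination (-vseq (a + d) (n + 1)) * h

lemma wseq_vseq (t : R) (m q : ℤ) (h : q * t = m) (n : ℕ) :
    (q : R) ^ n * vseq t (n + 1) = wseq m q (n + 1) := by
  induction n using Nat.twoStepInduction with
  | zero => simp [vseq, wseq]
  | one => simp [vseq, wseq, h]
  | more n h1 h2 =>
    rw [vseq, wseq]
    push_cast
    rw [← h1, ← h2, ← h]
    ring

lemma wseq_odd (m q : ℤ) (hm : Odd m) (hq : Even q) (n : ℕ) : Odd (wseq m q (n + 1)) := by
  induction n with
  | zero => simp [wseq]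
  | succ n ih =>
    rw [wseq]
    exact (hm.mul ih).sub_even ((hq.pow_of_ne_zero two_ne_zero).mul_right _)

lemma wseq_big (m : ℤ) (hm : 2 ≤ |m|) (n : ℕ) : |wseq m 1 n| < |wseq m 1 (n + 1)| := by
  induction n with
  | zero => simp [wseq]
  | succ n ih =>
    rw [wseq]
    have h1 : |m * wseq m 1 (n + 1)| - |1 ^ 2 * wseq m 1 n| ≤
      |m * wseq m 1 (n + 1) - 1 ^ 2 * wseq m 1 n| := abs_sub_abs_le_abs_sub _ _
    rw [abs_mul, one_pow, one_mul] at h1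
    rw [one_pow, one_mul]
    nlinarith [abs_nonneg (wseq m 1 (n + 1))]

lemma exists_num' (x : R) : ∃ (k : ℕ) (m : ℤ), (2 : R) ^ k * x = m ∧ (k = 0 ∨ Odd m) := by
  obtain ⟨k, m, h⟩ := exists_num x
  induction k generalizing m with
  | zero => exact ⟨0, m, h, Or.inl rfl⟩
  | succ k ih =>
    rcases Int.even_or_odd m with ⟨r, hr⟩ | ho
    · apply ih r
      apply mul_left_cancel₀ (two_ne_zero (α := R))
      rw [hr] at h; push_cast at h
      linear_combination h
    · exact ⟨k + 1, m, h, Or.inr ho⟩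

lemma vseq_ne (t : R) (n : ℕ) (h : vseq t (n + 1) = 0) : t = 0 ∨ t = 1 ∨ t = -1 := by
  obtain ⟨k, m, hk, hm⟩ := exists_num' t
  have h1 := wseq_vseq t m (2 ^ k) (by push_cast; exact hk) n
  rw [h, mul_zero] at h1
  have h2 : wseq m (2 ^ k) (n + 1) = 0 := by
    apply cast_inj; rw [← h1]; simp
  rcases Nat.eq_zero_or_pos k with rfl | hk0
  · have hb : ¬ 2 ≤ |m| := by
      intro hm2
      have := wseq_big m hm2 n
      rw [pow_zero] at h2
      rw [h2] at this
      simp at this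
      exact absurd this (not_lt.2 (abs_nonneg _))
    have : m = 0 ∨ m = 1 ∨ m = -1 := by
      have := abs_lt.1 (not_le.1 hb)
      omega
    rw [pow_zero, one_mul] at hk
    rcases this with rfl | rfl | rfl
    · left; simpa using hk
    · right; left; simpa using hk
    · right; right; simpa using hk
  · have ho : Odd m := by
      rcases hm with h | h
      · omega
      · exact h
    have := wseq_odd m (2 ^ k) ho (even_two.pow_of_ne_zero hk0.ne') n
    rw [h2] at this
    simp at this

lemma trichotomy (x : PSL2ZHalf) (hx : IsOfFinOrder x) : x = 1 ∨
    (∃ a b c d h, a + d = 0 ∧ x = pr (mk a b c d h)) ∨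
    (∃ a b c d h, a + d = -1 ∧ x = pr (mk a b c d h)) := by
  obtain ⟨g, rfl⟩ := QuotientGroup.mk'_surjective _ x
  obtain ⟨a, b, c, d, h, rfl⟩ := exists_mk g
  obtain ⟨n, hn, hpow⟩ := isOfFinOrder_iff_pow_eq_one.1 hx
  obtain ⟨n, rfl⟩ := Nat.exists_eq_succ_of_ne_zero hn.ne'
  obtain ⟨hh, e⟩ := pow_mk a b c d h n
  change pr _ ^ (n + 1) = 1 at hpow
  rw [← map_pow, e, eq_comm, ← map_one pr, one_eq, pr_eq] at hpow
  by_cases hv : vseq (a + d) (n + 1) = 0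
  · right
    rcases vseq_ne _ _ hv with h1 | h1 | h1
    · exact Or.inl ⟨a, b, c, d, h, h1, rfl⟩
    · refine Or.inr ⟨-a, -b, -c, -d, by linear_combination h, by linear_combination -h1, ?_⟩
      change pr _ = _
      rw [pr_eq]
      exact Or.inr ⟨rfl, rfl, rfl, rfl⟩
    · exact Or.inr ⟨a, b, c, d, h, h1, rfl⟩
  · left
    change pr _ = 1
    have : b = 0 ∧ c = 0 ∧ a = d := by
      refine ⟨?_, ?_, ?_⟩ <;> apply mul_left_cancel₀ hv
      · rcases hpow with ⟨e1, e2, e3, e4⟩ | ⟨e1, e2, e3, e4⟩ <;> linear_combination e2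
      · rcases hpow with ⟨e1, e2, e3, e4⟩ | ⟨e1, e2, e3, e4⟩ <;> linear_combination e3
      · rcases hpow with ⟨e1, e2, e3, e4⟩ | ⟨e1, e2, e3, e4⟩ <;> linear_combination e1 - e4
    obtain ⟨rfl, rfl, rfl⟩ := this
    have ha : (a - 1) * (a + 1) = 0 := by linear_combination h
    rw [eq_comm, ← map_one pr, one_eq, pr_eq]
    rcases mul_eq_zero.1 ha with h1 | h1
    · left; exact ⟨by linear_combination h1, rfl, rfl, by linear_combination h1⟩
    · right; exact ⟨by linear_combination h1, by ring, by ring, by linear_combination h1⟩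

lemma order_cases (x : PSL2ZHalf) (hx : IsOfFinOrder x) : x = 1 ∨
    (orderOf x = 2 ∧ IsConj x (pr (nf 0 1))) ∨
    (orderOf x = 3 ∧ ∃ i, IsConj x (pr (nf (-1) (rep i)))) := by
  rcases trichotomy x hx with h | ⟨a, b, c, d, h, had, rfl⟩ | ⟨a, b, c, d, h, had, rfl⟩
  · exact Or.inl h
  · right; left
    refine ⟨order_two _ _ _ _ _ had, ?_⟩
    obtain ⟨w, hw⟩ := exists_nf 0 (Or.inl rfl) a b c d h (by simpa using had)
    rw [Int.cast_zero] at hw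
    have e : pr (nf 0 (-1)) = pr (nf 0 1) := by
      rw [nf, nf, pr_eq]
      right; simp [units_neg_inv]
    rcases nf_zero w with h2 | h2
    · exact pr.map_isConj (hw.trans h2)
    · rw [← e]; exact pr.map_isConj (hw.trans h2)
  · right; right
    refine ⟨order_three _ _ _ _ _ had, ?_⟩
    obtain ⟨w, hw⟩ := exists_nf (-1) (Or.inr rfl) a b c d h (by simpa using had)
    rw [show (((-1 : ℤ)) : R) = -1 by simp] at hw
    obtain ⟨i, hi⟩ := nf_rep (-1) w
    exact ⟨i, pr.map_isConj (hw.trans hi)⟩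

lemma pr_inj (i j : Fin 4) (h : IsConj (pr (nf (-1) (rep i))) (pr (nf (-1) (rep j)))) : i = j := by
  apply nf_inj
  rw [isConj_iff] at h ⊢
  obtain ⟨x, hx⟩ := h
  obtain ⟨g, rfl⟩ := QuotientGroup.mk'_surjective _ x
  refine ⟨g, ?_⟩
  obtain ⟨p, q, r, s, hg, rfl⟩ := exists_mk g
  rw [mul_inv_eq_iff_eq_mul] at hx ⊢
  change pr _ * pr _ = pr _ * pr _ at hx
  rw [← map_mul, ← map_mul, nf, nf, mk_mul, mk_mul, pr_eq] at hx
  rw [nf, nf, mk_mul, mk_mul]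
  rcases hx with ⟨e1, e2, e3, e4⟩ | ⟨e1, e2, e3, e4⟩
  · exact mk_congr e1.symm e2.symm e3.symm e4.symm
  · exfalso
    have hw : (rep j : R) * (((rep j)⁻¹ : Rˣ) : R) = 1 := (rep j).mul_inv
    have hu : (rep i : R) * (((rep i)⁻¹ : Rˣ) : R) = 1 := (rep i).mul_inv
    have : (2 : R) = 0 := by
      linear_combination (-s) * e1 + r * e2 + q * e3 - p * e4 - 2 * hg
    exact two_ne_zero this

noncomputable def cls (i : Fin 4) : ConjClasses PSL2ZHalf := ConjClasses.mk (pr (nf (-1) (rep i)))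

lemma cls_inj : Function.Injective cls := fun i j h =>
  pr_inj i j (ConjClasses.mk_eq_mk_iff_isConj.1 h)

lemma set1 : {c : ConjClasses PSL2ZHalf | ∃ g, c = ConjClasses.mk g ∧ orderOf g = 1} = {1} := by
  ext c
  simp only [Set.mem_ofPred_eq, Set.mem_singleton_iff, orderOf_eq_one_iff]
  constructor
  · rintro ⟨g, rfl, rfl⟩; rfl
  · rintro rfl; exact ⟨1, rfl, rfl⟩

lemma set2 : {c : ConjClasses PSL2ZHalf | ∃ g, c = ConjClasses.mk g ∧ orderOf g = 2} =
    {ConjClasses.mk (pr (nf 0 1))} := by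
  ext c
  simp only [Set.mem_ofPred_eq, Set.mem_singleton_iff]
  constructor
  · rintro ⟨g, rfl, hg⟩
    rcases order_cases g (orderOf_pos_iff.1 (by omega)) with rfl | ⟨_, h⟩ | ⟨h, _⟩
    · simp at hg
    · exact ConjClasses.mk_eq_mk_iff_isConj.2 h
    · omega
  · rintro rfl; exact ⟨_, rfl, order_two _ _ _ _ _ (by simp)⟩

lemma set3 : {c : ConjClasses PSL2ZHalf | ∃ g, c = ConjClasses.mk g ∧ orderOf g = 3} =
    Set.range cls := by
  ext c
  simp only [Set.mem_ofPred_eq, Set.mem_range]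
  constructor
  · rintro ⟨g, rfl, hg⟩
    rcases order_cases g (orderOf_pos_iff.1 (by omega)) with rfl | ⟨h, _⟩ | ⟨_, i, h⟩
    · simp at hg
    · omega
    · exact ⟨i, (ConjClasses.mk_eq_mk_iff_isConj.2 h).symm⟩
  · rintro ⟨i, rfl⟩; exact ⟨_, rfl, order_three _ _ _ _ _ (by simp)⟩

lemma setF : {c : ConjClasses PSL2ZHalf | ∃ g, c = ConjClasses.mk g ∧ IsOfFinOrder g} =
    {c | ∃ g, c = ConjClasses.mk g ∧ orderOf g = 1} ∪
    ({c | ∃ g, c = ConjClasses.mk g ∧ orderOf g = 2} ∪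
      {c | ∃ g, c = ConjClasses.mk g ∧ orderOf g = 3}) := by
  ext c
  simp only [Set.mem_ofPred_eq, Set.mem_union]
  constructor
  · rintro ⟨g, rfl, hg⟩
    rcases order_cases g hg with h | ⟨h, _⟩ | ⟨h, _⟩
    · exact Or.inl ⟨g, rfl, orderOf_eq_one_iff.2 h⟩
    · exact Or.inr (Or.inl ⟨g, rfl, h⟩)
    · exact Or.inr (Or.inr ⟨g, rfl, h⟩)
  · rintro (⟨g, rfl, h⟩ | ⟨g, rfl, h⟩ | ⟨g, rfl, h⟩) <;>
      exact ⟨g, rfl, orderOf_pos_iff.1 (by omega)⟩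

lemma isConj_orderOf {x y : PSL2ZHalf} (h : IsConj x y) : orderOf x = orderOf y := by
  obtain ⟨c, hc⟩ := isConj_iff.1 h
  rw [← hc]
  exact (MulEquiv.orderOf_eq (MulAut.conj c) x).symm

lemma disj (m n : ℕ) (h : m ≠ n) :
    Disjoint {c : ConjClasses PSL2ZHalf | ∃ g, c = ConjClasses.mk g ∧ orderOf g = m}
      {c : ConjClasses PSL2ZHalf | ∃ g, c = ConjClasses.mk g ∧ orderOf g = n} := by
  rw [Set.disjoint_left]
  rintro c ⟨g, rfl, hg⟩ ⟨g', e, hg'⟩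
  apply h
  rw [← hg, ← hg']
  exact isConj_orderOf (ConjClasses.mk_eq_mk_iff_isConj.1 e)

end PslHalf

/-- `PSL₂(ℤ[1/2])` has exactly 6 conjugacy classes of elements of finite order:
the identity, one class of elements of order 2, and four classes of elements of order 3. -/
theorem psl2_z_half_finite_order_conjClasses :
    Nat.card {c : ConjClasses PSL2ZHalf | ∃ g, c = ConjClasses.mk g ∧ IsOfFinOrder g} = 6 ∧
    Nat.card {c : ConjClasses PSL2ZHalf | ∃ g, c = ConjClasses.mk g ∧ orderOf g = 1} = 1 ∧
    Nat.card {c : ConjClasses PSL2ZHalf | ∃ g, c = ConjClasses.mk g ∧ orderOf g = 2} = 1 ∧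
    Nat.card {c : ConjClasses PSL2ZHalf | ∃ g, c = ConjClasses.mk g ∧ orderOf g = 3} = 4 := by
  have c1 : Set.ncard {c : ConjClasses PSL2ZHalf | ∃ g, c = ConjClasses.mk g ∧ orderOf g = 1}
      = 1 := by rw [PslHalf.set1, Set.ncard_singleton]
  have c2 : Set.ncard {c : ConjClasses PSL2ZHalf | ∃ g, c = ConjClasses.mk g ∧ orderOf g = 2}
      = 1 := by rw [PslHalf.set2, Set.ncard_singleton]
  have c3 : Set.ncard {c : ConjClasses PSL2ZHalf | ∃ g, c = ConjClasses.mk g ∧ orderOf g = 3}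
      = 4 := by
    rw [PslHalf.set3, ← Set.image_univ, Set.ncard_image_of_injective _ PslHalf.cls_inj,
      Set.ncard_univ, Nat.card_fin]
  refine ⟨?_, c1, c2, c3⟩
  change Set.ncard {c : ConjClasses PSL2ZHalf | ∃ g, c = ConjClasses.mk g ∧ IsOfFinOrder g} = 6
  have f1 := Set.finite_of_ncard_ne_zero (by rw [c1]; norm_num)
  have f2 := Set.finite_of_ncard_ne_zero (by rw [c2]; norm_num)
  have f3 := Set.finite_of_ncard_ne_zero (by rw [c3]; norm_num)
  rw [PslHalf.setF, Set.ncard_union_eq _ f1 (f2.union f3),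
    Set.ncard_union_eq (PslHalf.disj 2 3 (by norm_num)) f2 f3, c1, c2, c3]
  rw [Set.disjoint_union_right]
  exact ⟨PslHalf.disj 1 2 (by norm_num), PslHalf.disj 1 3 (by norm_num)⟩
end

section
/- Let Γ be a Fuchsian group with s = 0 Bredon chain data: the chain complex 0 → Z --∂_2--> Z^{2g+r} --∂_1--> Z ⊕ Z^{m_1} ⊕ ... ⊕ Z^{m_r} → 0 with ∂_2 = 0, ∂_1(a_i) = 0 for the first 2g generators, and ∂_1(y_j) = Σ_{l=1}^{m_j} x_{j,l} − z for the last r generators. Then H_0 ≅ Z^{1 + Σ_j (m_j − 1)}, H_1 ≅ Z^{2g}, and H_2 ≅ Z. -/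
/-- The Bredon differential `∂₁ : ℤ^{2g+r} → ℤ ⊕ ℤ^{m₁} ⊕ ⋯ ⊕ ℤ^{m_r}` for a cocompact
Fuchsian group of signature `[g, 0; m₁, …, m_r]`: the `2g` generators `a_i` map to `0` and
`y_j ↦ ∑_l x_{j,l} − z` (index `none` is `z`, `some ⟨j,l⟩` is `x_{j,l}`). -/
def fuchsDiff1 (g : ℕ) {r : ℕ} (m : Fin r → ℕ) :
    ((Fin (2 * g) ⊕ Fin r) → ℤ) →ₗ[ℤ] ((Option ((j : Fin r) × Fin (m j))) → ℤ) :=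
  LinearMap.pi fun i =>
    match i with
    | none => -(∑ j : Fin r, LinearMap.proj (Sum.inr j))
    | some x => LinearMap.proj (Sum.inr x.1)

/-- The map whose kernel is the range of `∂₁`. -/
def fuchsPhi {r : ℕ} (m : Fin r → ℕ) (hm : ∀ j, 0 < m j) :
    ((Option ((j : Fin r) × Fin (m j))) → ℤ) →ₗ[ℤ]
      ((Option ((j : Fin r) × Fin (m j - 1))) → ℤ) where
  toFun f i := match i with
    | none => f none + ∑ j : Fin r, f (some ⟨j, ⟨0, hm j⟩⟩)
    | some x => f (some ⟨x.1, ⟨x.2.1 + 1, by have := x.2.2; omega⟩⟩) - f (some ⟨x.1, ⟨0, hm x.1⟩⟩)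
  map_add' f h := by
    ext i
    rcases i with _ | x
    · simp [Finset.sum_add_distrib]; ring
    · simp; ring
  map_smul' c f := by
    ext i
    rcases i with _ | x
    · simp [Finset.mul_sum, mul_add]
    · simp [mul_sub]

theorem fuchsDiff1_none (g : ℕ) {r : ℕ} (m : Fin r → ℕ) (v : (Fin (2 * g) ⊕ Fin r) → ℤ) :
    fuchsDiff1 g m v none = -∑ j : Fin r, v (Sum.inr j) := by
  simp [fuchsDiff1]

theorem fuchsDiff1_some (g : ℕ) {r : ℕ} (m : Fin r → ℕ) (v : (Fin (2 * g) ⊕ Fin r) → ℤ)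
    (x : (j : Fin r) × Fin (m j)) :
    fuchsDiff1 g m v (some x) = v (Sum.inr x.1) := by
  simp [fuchsDiff1]

theorem fuchsPhi_surj {r : ℕ} (m : Fin r → ℕ) (hm : ∀ j, 0 < m j) :
    Function.Surjective (fuchsPhi m hm) := by
  intro h
  refine ⟨fun i => match i with
    | none => h none
    | some x => if hx : x.2.1 = 0 then 0 else
        h (some ⟨x.1, ⟨x.2.1 - 1, by have := x.2.2; omega⟩⟩), ?_⟩
  ext i
  rcases i with _ | x
  · simp [fuchsPhi]
  · simp [fuchsPhi]

theorem fuchsPhi_ker (g : ℕ) {r : ℕ} (m : Fin r → ℕ) (hm : ∀ j, 0 < m j) :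
    LinearMap.ker (fuchsPhi m hm) = LinearMap.range (fuchsDiff1 g m) := by
  ext f
  rw [LinearMap.mem_ker, LinearMap.mem_range]
  constructor
  · intro hf
    refine ⟨Sum.elim 0 (fun j => f (some ⟨j, ⟨0, hm j⟩⟩)), ?_⟩
    ext i
    rcases i with _ | ⟨j, l, hl⟩
    · rw [fuchsDiff1_none]
      have h0 : f none + ∑ j : Fin r, f (some ⟨j, ⟨0, hm j⟩⟩) = 0 := congrFun hf none
      simp only [Sum.elim_inr]
      linarith
    · rw [fuchsDiff1_some]
      simp only [Sum.elim_inr]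
      rcases l with _ | l
      · rfl
      · have h0 : f (some ⟨j, ⟨l + 1, hl⟩⟩) - f (some ⟨j, ⟨0, hm j⟩⟩) = 0 :=
          congrFun hf (some ⟨j, ⟨l, by omega⟩⟩)
        linarith
  · rintro ⟨v, rfl⟩
    ext i
    rcases i with _ | x
    · simp [fuchsPhi, fuchsDiff1_none, fuchsDiff1_some]
    · simp [fuchsPhi, fuchsDiff1_some]

/-- For the chain complex `0 → ℤ --∂₂--> ℤ^{2g+r} --∂₁--> ℤ ⊕ ℤ^{m₁} ⊕ ⋯ ⊕ ℤ^{m_r} → 0`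
with `∂₂ = 0`, `∂₁(a_i) = 0` and `∂₁(y_j) = ∑_l x_{j,l} − z`, one has
`H₀ ≅ ℤ^{1+∑(m_j−1)}`, `H₁ ≅ ℤ^{2g}` and `H₂ ≅ ℤ`. -/
theorem fuchsian_cocompact_bredon_homology (g : ℕ) {r : ℕ} (m : Fin r → ℕ)
    (hm : ∀ j, 0 < m j)
    (d2 : (Fin 1 → ℤ) →ₗ[ℤ] ((Fin (2 * g) ⊕ Fin r) → ℤ)) (hd2 : d2 = 0) :
    Nonempty
      ((((Option ((j : Fin r) × Fin (m j))) → ℤ) ⧸ LinearMap.range (fuchsDiff1 g m)) ≃ₗ[ℤ]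
        (Fin (1 + ∑ j, (m j - 1)) → ℤ)) ∧
    Nonempty
      (((LinearMap.ker (fuchsDiff1 g m)) ⧸
          Submodule.comap (LinearMap.ker (fuchsDiff1 g m)).subtype (LinearMap.range d2)) ≃ₗ[ℤ]
        (Fin (2 * g) → ℤ)) ∧
    Nonempty ((LinearMap.ker d2) ≃ₗ[ℤ] ℤ) := by
  subst hd2
  refine ⟨⟨?_⟩, ⟨?_⟩, ⟨?_⟩⟩
  · refine (Submodule.quotEquivOfEq _ _ (fuchsPhi_ker g m hm).symm).trans
      (((fuchsPhi m hm).quotKerEquivOfSurjective (fuchsPhi_surj m hm)).trans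
        (LinearEquiv.funCongrLeft ℤ ℤ (Fintype.equivOfCardEq ?_)))
    simp [add_comm]
  · let p : LinearMap.ker (fuchsDiff1 g m) →ₗ[ℤ] (Fin (2 * g) → ℤ) :=
      (LinearMap.funLeft ℤ ℤ Sum.inl).comp (LinearMap.ker (fuchsDiff1 g m)).subtype
    have hp : Function.Surjective p := by
      intro a
      refine ⟨⟨Sum.elim a 0, ?_⟩, ?_⟩
      · rw [LinearMap.mem_ker]
        ext i
        rcases i with _ | x
        · simp [fuchsDiff1_none]
        · simp [fuchsDiff1_some]
      · ext i
        simp [p, LinearMap.funLeft]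
    refine (Submodule.quotEquivOfEq _ _ ?_).trans (p.quotKerEquivOfSurjective hp)
    ext ⟨v, hv⟩
    rw [LinearMap.mem_ker] at hv
    simp only [LinearMap.range_zero, Submodule.mem_comap, Submodule.mem_bot, LinearMap.mem_ker,
      Submodule.subtype_apply]
    constructor
    · rintro rfl
      ext i
      simp [p, LinearMap.funLeft]
    · intro h
      ext i
      rcases i with i | j
      · exact congrFun h i
      · have h1 := congrFun hv (some ⟨j, ⟨0, hm j⟩⟩)
        rw [fuchsDiff1_some] at h1
        exact h1
  · exact (LinearEquiv.ofEq _ _ LinearMap.ker_zero).trans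
      (Submodule.topEquiv.trans (LinearEquiv.funUnique (Fin 1) ℤ ℤ))
end

section
/- Z[1/p] is generated as a ring by 1/p, and SL_2(Z[1/p]) is generated by SL_2(Z) together with the diagonal matrix diag(p, 1/p); equivalently, the two standard copies of SL_2(Z) inside SL_2(Z[1/p]) (the identity embedding and its conjugate by diag(p,1)) generate SL_2(Z[1/p]). -/
/-- The diagonal matrix `diag(p, 1/p)` as an element of `SL₂(ℤ[1/p])`. -/
noncomputable def diagP (p : ℕ) :
    Matrix.SpecialLinearGroup (Fin 2) (Localization.Away (p : ℤ)) :=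
  ⟨!![algebraMap ℤ (Localization.Away (p : ℤ)) (p : ℤ), 0; 0,
      IsLocalization.Away.invSelf (S := Localization.Away (p : ℤ)) (p : ℤ)], by
    rw [Matrix.det_fin_two_of]
    have h := IsLocalization.Away.mul_invSelf (S := Localization.Away (p : ℤ)) (p : ℤ)
    simpa using h⟩

open Matrix in
/-- Upper unipotent matrix. -/
def upT {R : Type*} [CommRing R] (x : R) : SpecialLinearGroup (Fin 2) R :=
  ⟨!![1, x; 0, 1], by simp [Matrix.det_fin_two_of]⟩

open Matrix in
/-- The Weyl element. -/
def wS (R : Type*) [CommRing R] : SpecialLinearGroup (Fin 2) R :=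
  ⟨!![0, -1; 1, 0], by simp [Matrix.det_fin_two_of]⟩

open Matrix in
theorem coe_upT {R : Type*} [CommRing R] (x : R) :
    ((upT x : SpecialLinearGroup (Fin 2) R) : Matrix (Fin 2) (Fin 2) R) = !![1, x; 0, 1] := rfl

open Matrix in
theorem coe_wS (R : Type*) [CommRing R] :
    ((wS R : SpecialLinearGroup (Fin 2) R) : Matrix (Fin 2) (Fin 2) R) = !![0, -1; 1, 0] := rfl

open Matrix in
/-- Upper triangular matrices are products of elementary ones. -/
theorem upper_mem {R : Type*} [CommRing R] (H : Subgroup (SpecialLinearGroup (Fin 2) R))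
    (hT : ∀ x : R, upT x ∈ H) (hS : wS R ∈ H)
    (M : SpecialLinearGroup (Fin 2) R) (h : M 1 0 = 0) : M ∈ H := by
  have hdet := M.det_coe
  rw [Matrix.det_fin_two] at hdet
  have h' : (M : Matrix (Fin 2) (Fin 2) R) 1 0 = 0 := h
  rw [h', mul_zero, sub_zero] at hdet
  set a := (M : Matrix (Fin 2) (Fin 2) R) 0 0 with ha
  set b := (M : Matrix (Fin 2) (Fin 2) R) 0 1 with hb
  set d := (M : Matrix (Fin 2) (Fin 2) R) 1 1 with hd
  have key : M * (wS R)⁻¹ = upT (a * b) * (upT a * (wS R * upT d * (wS R)⁻¹) * upT a) := by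
    have hM : (M : Matrix (Fin 2) (Fin 2) R) = !![a, b; 0, d] := by
      ext i j; fin_cases i <;> fin_cases j <;> simp [ha, hb, hd, h']
    refine (Matrix.SpecialLinearGroup.ext_iff _ _).2 fun i j => ?_
    simp only [Matrix.SpecialLinearGroup.coe_mul, Matrix.SpecialLinearGroup.coe_inv, hM, coe_upT, coe_wS,
      Matrix.adjugate_fin_two_of]
    clear_value a b d
    fin_cases i <;> fin_cases j <;> simp [Matrix.mul_apply, Fin.sum_univ_two] <;> grind
  have : M = upT (a * b) * (upT a * (wS R * upT d * (wS R)⁻¹) * upT a) * wS R := by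
    rw [← key]; group
  rw [this]
  exact H.mul_mem (H.mul_mem (hT _) (H.mul_mem (H.mul_mem (hT _)
    (H.mul_mem (H.mul_mem hS (hT _)) (H.inv_mem hS))) (hT _))) hS

open Matrix in
theorem exists_row (a c : ℤ) : ∃ g : SpecialLinearGroup (Fin 2) ℤ, g 1 0 * a + g 1 1 * c = 0 := by
  by_cases h0 : (Int.gcd a c : ℤ) = 0
  · have h1 : Int.gcd a c = 0 := by exact_mod_cast h0
    rw [Int.gcd_eq_zero_iff] at h1
    exact ⟨1, by simp [h1.1, h1.2]⟩
  · obtain ⟨a', ha⟩ := Int.gcd_dvd_left a c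
    obtain ⟨c', hc⟩ := Int.gcd_dvd_right a c
    have hb := Int.gcd_eq_gcd_ab a c
    refine ⟨⟨!![Int.gcdA a c, Int.gcdB a c; -c', a'], ?_⟩, ?_⟩
    · rw [Matrix.det_fin_two_of]
      apply mul_left_cancel₀ h0
      generalize (Int.gcd a c : ℤ) = g at *
      generalize Int.gcdA a c = x at *
      generalize Int.gcdB a c = y at *
      subst ha hc
      linear_combination -hb
    · change -c' * a + a' * c = 0
      linear_combination -c' * ha + a' * hc

/-- `ℤ[1/p]` is generated as a ring by `1/p`, and `SL₂(ℤ[1/p])` is generated by the image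
of `SL₂(ℤ)` together with the diagonal matrix `diag(p, 1/p)`. -/
theorem zInvP_ring_closure_and_sl2_generation (p : ℕ) (hp : p.Prime) :
    Subring.closure
        {IsLocalization.Away.invSelf (S := Localization.Away (p : ℤ)) (p : ℤ)} = ⊤ ∧
    Subgroup.closure
        (Set.range
            (Matrix.SpecialLinearGroup.map (n := Fin 2)
              (algebraMap ℤ (Localization.Away (p : ℤ)))) ∪ {diagP p}) = ⊤ := by
  classical
  set A := Localization.Away (p : ℤ) with hA
  set u : A := algebraMap ℤ A (p : ℤ) with hu
  set v : A := IsLocalization.Away.invSelf (S := A) (p : ℤ) with hv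
  have huv : u * v = 1 := IsLocalization.Away.mul_invSelf (S := A) (p : ℤ)
  have hsurj : ∀ x : A, ∃ (n : ℕ) (k : ℤ), x * u ^ n = algebraMap ℤ A k := fun x =>
    IsLocalization.Away.surj (p : ℤ) x
  have hpow : ∀ n : ℕ, u ^ n * v ^ n = 1 := fun n => by rw [← mul_pow, huv, one_pow]
  refine ⟨?_, ?_⟩
  · rw [eq_top_iff]
    intro x _
    obtain ⟨n, k, h⟩ := hsurj x
    have hx : x = (k : A) * v ^ n := by
      have h' : x * u ^ n = (k : A) := by rw [h]; simp
      rw [← h', mul_assoc, hpow, mul_one]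
    rw [hx]
    exact Subring.mul_mem _ (intCast_mem _ k)
      (Subring.pow_mem _ (Subring.subset_closure (Set.mem_singleton _)) n)
  · set H := Subgroup.closure (Set.range (Matrix.SpecialLinearGroup.map (n := Fin 2)
      (algebraMap ℤ A)) ∪ {diagP p}) with hH
    have hZ : ∀ g, Matrix.SpecialLinearGroup.map (n := Fin 2) (algebraMap ℤ A) g ∈ H :=
      fun g => Subgroup.subset_closure (Or.inl ⟨g, rfl⟩)
    have hD : diagP p ∈ H := Subgroup.subset_closure (Or.inr rfl)
    have hS : wS A ∈ H := by
      have := hZ (wS ℤ)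
      convert this using 1
      refine Matrix.SpecialLinearGroup.ext_iff _ _ |>.2 fun i j => ?_
      rw [Matrix.SpecialLinearGroup.map_apply_coe, coe_wS, coe_wS]
      fin_cases i <;> fin_cases j <;> simp
    have hTZ : ∀ k : ℤ, upT (algebraMap ℤ A k) ∈ H := by
      intro k
      have := hZ (upT k)
      convert this using 1
      refine Matrix.SpecialLinearGroup.ext_iff _ _ |>.2 fun i j => ?_
      rw [Matrix.SpecialLinearGroup.map_apply_coe, coe_upT, coe_upT]
      fin_cases i <;> fin_cases j <;> simp
    have hstep : ∀ x : A, upT (x * u ^ 2) ∈ H → upT x ∈ H := by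
      intro x hx
      have key : upT x = (diagP p)⁻¹ * upT (x * u ^ 2) * diagP p := by
        rw [mul_assoc, eq_inv_mul_iff_mul_eq]
        have hdc : ((diagP p : Matrix.SpecialLinearGroup (Fin 2) A) :
            Matrix (Fin 2) (Fin 2) A) = !![u, 0; 0, v] := rfl
        refine Matrix.SpecialLinearGroup.ext_iff _ _ |>.2 fun i j => ?_
        simp only [Matrix.SpecialLinearGroup.coe_mul, coe_upT, hdc]
        clear_value u v
        fin_cases i <;> fin_cases j <;> simp [Matrix.mul_apply, Fin.sum_univ_two]
        linear_combination (-x * u) * huv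
      rw [key]
      exact H.mul_mem (H.mul_mem (H.inv_mem hD) hx) hD
    have hsteps : ∀ (n : ℕ) (x : A), upT (x * (u ^ 2) ^ n) ∈ H → upT x ∈ H := by
      intro n
      induction n with
      | zero => intro x hx; simpa using hx
      | succ n ih =>
        intro x hx
        apply hstep
        apply ih
        rw [pow_succ'] at hx
        rwa [mul_assoc]
    have hT : ∀ x : A, upT x ∈ H := by
      intro x
      obtain ⟨n, k, h⟩ := hsurj x
      apply hsteps n
      have : x * (u ^ 2) ^ n = algebraMap ℤ A (k * (p : ℤ) ^ n) := by
        rw [map_mul, map_pow, ← h, ← hu]; ring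
      rw [this]
      exact hTZ _
    rw [eq_top_iff]
    intro M _
    obtain ⟨n, k, h1⟩ := hsurj (M 0 0)
    obtain ⟨m, l, h2⟩ := hsurj (M 1 0)
    obtain ⟨g, hg⟩ := exists_row (k * (p : ℤ) ^ m) (l * (p : ℤ) ^ n)
    have hgA := congrArg (algebraMap ℤ A) hg
    rw [map_add, map_mul, map_mul, map_mul, map_mul, map_pow, map_pow, ← h1, ← h2, ← hu,
      map_zero] at hgA
    have hmem := upper_mem H hT hS
      (Matrix.SpecialLinearGroup.map (n := Fin 2) (algebraMap ℤ A) g * M) (by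
        have e : (Matrix.SpecialLinearGroup.map (n := Fin 2) (algebraMap ℤ A) g * M) 1 0
            = algebraMap ℤ A (g 1 0) * M 0 0 + algebraMap ℤ A (g 1 1) * M 1 0 := by
          change ((Matrix.SpecialLinearGroup.map (n := Fin 2) (algebraMap ℤ A) g * M :
            Matrix.SpecialLinearGroup (Fin 2) A) : Matrix (Fin 2) (Fin 2) A) 1 0 = _
          rw [Matrix.SpecialLinearGroup.coe_mul, Matrix.mul_apply, Fin.sum_univ_two]
          rfl
        rw [e]
        have hw := hpow (n + m)
        generalize algebraMap ℤ A (g 1 0) = r at *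
        generalize algebraMap ℤ A (g 1 1) = s at *
        generalize M 0 0 = x at *
        generalize M 1 0 = y at *
        have : (r * x + s * y) * u ^ (n + m) = 0 := by rw [← hgA]; ring
        linear_combination v ^ (n + m) * this - (r * x + s * y) * hw)
    exact (H.mul_mem_cancel_left (hZ g)).1 hmem
end
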